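/- Let p be an odd prime, let a ∈ ℚ_p be nonzero with p-adic valuation v(a) = 0, and let b ∈ ℚ_p be nonzero. Then the quaternion algebra ℍ[ℚ_p, a, b] is isomorphic as a ℚ_p-algebra to the 2×2 matrix algebra over ℚ_p if and only if a is a square in ℚ_p or the p-adic valuation v(b) is even. Equivalently, the Hilbert symbol satisfies (a,b)_p = (a/p)^{v(b)}, where (a/p) is the Legendre symbol of the residue of a. -/

import Mathlib

open Quaternion

/-- The Hilbert symbol `(a, b)_F`: it is `1` if `ℍ[F, a, b]` is isomorphic to the
`2 × 2` matrix algebra over `F`, and `-1` otherwise. -/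
noncomputable def hilbertSym (F : Type*) [Field F] (a b : F) : ℤ :=
  open scoped Classical in
  if Nonempty (ℍ[F, a, b] ≃ₐ[F] Matrix (Fin 2) (Fin 2) F) then 1 else -1

namespace QuaternionAlgebra

variable {F : Type*} [Field F] {a b : F}

/-- If `b = x ^ 2 - a * y ^ 2`, then `ℍ[F, a, b]` is generated inside `M₂(F)` by the matrices
`!![0, a; 1, 0]` and `!![x, -a * y; y, -x]`. -/
def matrixBasis (a b x y : F) (h : b = x ^ 2 - a * y ^ 2) :
    QuaternionAlgebra.Basis (Matrix (Fin 2) (Fin 2) F) a 0 b where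
  i := !![0, a; 1, 0]
  j := !![x, -a * y; y, -x]
  k := !![a * y, -a * x; x, -a * y]
  i_mul_i := by
    ext i j; fin_cases i <;> fin_cases j <;> simp
  j_mul_j := by
    subst h
    ext i j; fin_cases i <;> fin_cases j <;> simp <;> ring
  i_mul_j := by
    ext i j; fin_cases i <;> fin_cases j <;> simp
  j_mul_i := by
    ext i j; fin_cases i <;> fin_cases j <;> simp <;> ring

theorem nonempty_algEquiv_matrix_of_eq_sq_sub_mul_sq (h2 : (2 : F) ≠ 0) (ha : a ≠ 0) (hb : b ≠ 0)
    {x y : F} (h : b = x ^ 2 - a * y ^ 2) :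
    Nonempty (ℍ[F, a, b] ≃ₐ[F] Matrix (Fin 2) (Fin 2) F) := by
  let f : ℍ[F, a, b] →ₐ[F] Matrix (Fin 2) (Fin 2) F := (matrixBasis a b x y h).liftHom
  have hinj : Function.Injective f := by
    rw [injective_iff_map_eq_zero]
    rintro ⟨r, s, t, u⟩ hq
    have hq' : (matrixBasis a b x y h).lift ⟨r, s, t, u⟩ = 0 := hq
    simp only [Basis.lift, matrixBasis, Algebra.algebraMap_eq_smul_one] at hq'
    have h00 := congrFun (congrFun hq' 0) 0
    have h01 := congrFun (congrFun hq' 0) 1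
    have h10 := congrFun (congrFun hq' 1) 0
    have h11 := congrFun (congrFun hq' 1) 1
    simp at h00 h01 h10 h11
    have hr : r = 0 := by
      apply (mul_eq_zero.1 (?_ : 2 * r = 0)).resolve_left h2
      linear_combination h00 + h11
    have hs : s = 0 := by
      apply (mul_eq_zero.1 (?_ : (2 * a) * s = 0)).resolve_left (mul_ne_zero h2 ha)
      linear_combination h01 + a * h10
    subst hr hs
    have ht : t = 0 := by
      apply (mul_eq_zero.1 (?_ : b * t = 0)).resolve_left hb
      rw [h]
      linear_combination x * h00 - a * y * h10
    have hu : u = 0 := by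
      apply (mul_eq_zero.1 (?_ : b * u = 0)).resolve_left hb
      rw [h]
      linear_combination x * h10 - y * h00
    subst ht hu
    rfl
  have hdim : Module.finrank F ℍ[F, a, b] = Module.finrank F (Matrix (Fin 2) (Fin 2) F) := by
    rw [QuaternionAlgebra.finrank_eq_four, Module.finrank_matrix]
    simp
  exact ⟨AlgEquiv.ofBijective f
    ⟨hinj, (LinearMap.injective_iff_surjective_of_finrank_eq_finrank hdim
      (f := f.toLinearMap)).1 hinj⟩⟩

/-- The norm form of a split quaternion algebra is isotropic. -/
theorem exists_norm_eq_zero_of_algEquiv_matrix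
    (e : ℍ[F, a, b] ≃ₐ[F] Matrix (Fin 2) (Fin 2) F) :
    ∃ q : ℍ[F, a, b], q ≠ 0 ∧
      q.re ^ 2 - a * q.imI ^ 2 = b * (q.imJ ^ 2 - a * q.imK ^ 2) := by
  let E : Matrix (Fin 2) (Fin 2) F := !![0, 1; 0, 0]
  have hE : E ≠ 0 := fun h => one_ne_zero (congrFun (congrFun h 0) 1 : (1 : F) = 0)
  have hEE : E * E = 0 := by
    ext i j; fin_cases i <;> fin_cases j <;> simp [E]
  have hq : e.symm E ≠ 0 := by simpa using hE
  have hqq : e.symm E * e.symm E = 0 := by rw [← map_mul, hEE, map_zero]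
  generalize e.symm E = q at hq hqq
  refine ⟨q, hq, ?_⟩
  have hN : (star q * q).re • q = 0 := by
    rw [← coe_mul_eq_smul, ← star_mul_eq_coe, mul_assoc, hqq, mul_zero]
  have hre := (smul_eq_zero.1 hN).resolve_right hq
  simp at hre
  linear_combination hre

end QuaternionAlgebra

namespace PadicInt

variable {p : ℕ} [Fact p.Prime]

theorem toZMod_eq_zero_iff_norm_lt_one {x : ℤ_[p]} : toZMod x = 0 ↔ ‖x‖ < 1 := by
  rw [← RingHom.mem_ker, ker_toZMod, IsLocalRing.mem_maximalIdeal, mem_nonunits]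

theorem toZMod_ne_zero_iff_norm_eq_one {x : ℤ_[p]} : toZMod x ≠ 0 ↔ ‖x‖ = 1 := by
  rw [Ne, toZMod_eq_zero_iff_norm_lt_one, not_lt]
  exact ⟨fun h => le_antisymm x.norm_le_one h, fun h => h.ge⟩

theorem isSquare_iff_isSquare_toZMod (hp : p ≠ 2) {z : ℤ_[p]} (hz : toZMod z ≠ 0) :
    IsSquare z ↔ IsSquare (toZMod z) := by
  refine ⟨fun h => h.map toZMod, ?_⟩
  rintro ⟨r, hr⟩
  obtain ⟨x, rfl⟩ := ZMod.ringHom_surjective (toZMod (p := p)) r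
  have h2 : (2 : ZMod p) ≠ 0 := Ring.two_ne_zero (by rwa [ZMod.ringChar_zmod_n])
  have hx : toZMod x ≠ 0 := by
    intro h
    simp [hr, h] at hz
  have hsmall : ‖x ^ 2 - z‖ < 1 := by
    rw [← toZMod_eq_zero_iff_norm_lt_one, map_sub, map_pow, hr]
    ring
  have hunit : ‖2 * x‖ = 1 := by
    rw [← toZMod_ne_zero_iff_norm_eq_one, map_mul, map_ofNat]
    exact mul_ne_zero h2 hx
  obtain ⟨y, hy, -⟩ := hensels_lemma (F := (Polynomial.X ^ 2 - Polynomial.C z : Polynomial ℤ_[p]))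
    (a := x) (by
      simp [one_add_one_eq_two] at hunit ⊢
      simpa [hunit] using hsmall)
  refine ⟨y, ?_⟩
  simp at hy
  linear_combination -hy

/-- Every unit of `ℤ_p` is a value of the form `x ^ 2 - a * y ^ 2` when `a` is a unit. -/
theorem exists_eq_sq_sub_mul_sq (hp : p ≠ 2) {a u : ℤ_[p]} (ha : toZMod a ≠ 0)
    (hu : toZMod u ≠ 0) : ∃ x y : ℚ_[p], (u : ℚ_[p]) = x ^ 2 - a * y ^ 2 := by
  obtain ⟨r, s, hrs⟩ := FiniteField.exists_root_sum_quadratic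
    (f := (Polynomial.X ^ 2 - Polynomial.C (toZMod u) : Polynomial (ZMod p)))
    (g := (Polynomial.C (-toZMod a) * Polynomial.X ^ 2 : Polynomial (ZMod p)))
    (Polynomial.degree_X_pow_sub_C (by decide) _)
    (Polynomial.degree_C_mul_X_pow 2 (neg_ne_zero.2 ha))
    (by rw [ZMod.card]; exact (Fact.out : p.Prime).eq_two_or_odd.resolve_left hp)
  simp at hrs
  by_cases hr : r = 0
  · have hau : toZMod (-(u * a)) ≠ 0 := by
      rw [map_neg, map_mul]
      exact neg_ne_zero.2 (mul_ne_zero hu ha)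
    obtain ⟨y, hy⟩ := (isSquare_iff_isSquare_toZMod hp hau).2 ⟨toZMod a * s, by
      subst hr
      rw [map_neg, map_mul]
      linear_combination toZMod a * hrs⟩
    have ha' : (a : ℚ_[p]) ≠ 0 := by
      rintro h
      apply ha
      rw [PadicInt.coe_eq_zero.1 h, map_zero]
    have hy' := congrArg ((↑) : ℤ_[p] → ℚ_[p]) hy
    push_cast at hy'
    refine ⟨0, y / a, ?_⟩
    field_simp
    linear_combination -hy'
  · obtain ⟨y, rfl⟩ := ZMod.ringHom_surjective (toZMod (p := p)) s
    have hsq : toZMod (u + a * y ^ 2) = r * r := by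
      simp only [map_add, map_mul, map_pow]
      linear_combination -hrs
    obtain ⟨x, hx⟩ := (isSquare_iff_isSquare_toZMod hp
      (hsq ▸ mul_ne_zero hr hr)).2 ⟨r, hsq⟩
    have hx' := congrArg ((↑) : ℤ_[p] → ℚ_[p]) hx
    push_cast at hx'
    exact ⟨x, y, by linear_combination hx'⟩

end PadicInt

namespace Padic

variable {p : ℕ} [Fact p.Prime]

theorem norm_eq_one_iff_valuation_eq_zero {x : ℚ_[p]} (hx : x ≠ 0) :
    ‖x‖ = 1 ↔ x.valuation = 0 := by
  have hp : 1 < (p : ℝ) := mod_cast (Fact.out : p.Prime).one_lt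
  rw [norm_eq_zpow_neg_valuation hx, zpow_eq_one_iff_right₀ (by linarith) hp.ne', neg_eq_zero]

theorem isSquare_coe_iff {z : ℤ_[p]} : IsSquare (z : ℚ_[p]) ↔ IsSquare z := by
  refine ⟨?_, fun h => h.map PadicInt.Coe.ringHom⟩
  rintro ⟨y, hy⟩
  have hy1 : ‖y‖ ≤ 1 := by
    have h := z.norm_le_one
    rw [PadicInt.norm_def, hy, norm_mul] at h
    nlinarith [norm_nonneg y]
  exact ⟨⟨y, hy1⟩, Subtype.ext hy⟩

/-- A value of the norm form of an unramified quadratic extension has even valuation. -/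
theorem even_valuation_sq_sub_mul_sq {z : ℤ_[p]} (hz : ¬IsSquare (PadicInt.toZMod z))
    (x y : ℚ_[p]) : Even (x ^ 2 - z * y ^ 2).valuation := by
  have hz0 : PadicInt.toZMod z ≠ 0 := fun h => hz (h ▸ IsSquare.zero)
  have hz1 : ‖(z : ℚ_[p])‖ = 1 := PadicInt.toZMod_ne_zero_iff_norm_eq_one.1 hz0
  have key : ∀ t : ℤ_[p], ‖t ^ 2 - z‖ = 1 ∧ ‖1 - z * t ^ 2‖ = 1 := by
    intro t
    simp only [← PadicInt.toZMod_ne_zero_iff_norm_eq_one, map_sub, map_mul, map_pow, map_one]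
    refine ⟨fun h => hz ⟨PadicInt.toZMod t, by linear_combination -h⟩, fun h => ?_⟩
    have ht : PadicInt.toZMod t ≠ 0 := by
      intro ht
      simp [ht] at h
    refine hz ⟨(PadicInt.toZMod t)⁻¹, ?_⟩
    field_simp
    linear_combination -h
  have scale : ∀ s w : ℚ_[p], s ≠ 0 → ‖w‖ = 1 → Even (s ^ 2 * w).valuation := by
    intro s w hs hw
    have hw0 : w ≠ 0 := norm_ne_zero_iff.1 (by rw [hw]; exact one_ne_zero)
    rw [valuation_mul (pow_ne_zero 2 hs) hw0, (norm_eq_one_iff_valuation_eq_zero hw0).1 hw,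
      valuation_pow]
    simp
  rcases eq_or_ne x 0 with rfl | hx
  · rcases eq_or_ne y 0 with rfl | hy
    · simp
    · have := scale y (-z) hy (by rwa [norm_neg])
      convert this using 2
      ring
  rcases le_total ‖y‖ ‖x‖ with h | h
  · have ht : ‖y / x‖ ≤ 1 := by
      rw [norm_div]
      exact div_le_one_of_le₀ h (norm_nonneg _)
    have := scale x (1 - z * (y / x) ^ 2) hx (key ⟨y / x, ht⟩).2
    convert this using 2
    field_simp
  · have hy : y ≠ 0 := norm_pos_iff.1 ((norm_pos_iff.2 hx).trans_le h)
    have ht : ‖x / y‖ ≤ 1 := by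
      rw [norm_div]
      exact div_le_one_of_le₀ h (norm_nonneg _)
    have := scale y ((x / y) ^ 2 - z) hy (key ⟨x / y, ht⟩).1
    convert this using 2
    field_simp

theorem exists_eq_sq_sub_mul_sq_of_even_valuation (hp : p ≠ 2) {z : ℤ_[p]}
    (hz : PadicInt.toZMod z ≠ 0) {b : ℚ_[p]} (hb : b ≠ 0) (hv : Even b.valuation) :
    ∃ x y : ℚ_[p], b = x ^ 2 - z * y ^ 2 := by
  obtain ⟨k, hk⟩ := hv
  have hp0 : (p : ℚ_[p]) ≠ 0 := mod_cast (Fact.out : p.Prime).ne_zero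
  set c : ℚ_[p] := (p : ℚ_[p]) ^ k
  have hc : c ≠ 0 := zpow_ne_zero k hp0
  have hcv : c.valuation = k := by simp [c]
  have hu : ‖b / c ^ 2‖ = 1 := by
    rw [norm_eq_one_iff_valuation_eq_zero (div_ne_zero hb (pow_ne_zero 2 hc)), div_eq_mul_inv,
      valuation_mul hb (inv_ne_zero (pow_ne_zero 2 hc)), valuation_inv, valuation_pow, hcv, hk]
    push_cast
    ring
  obtain ⟨x, y, hxy⟩ := PadicInt.exists_eq_sq_sub_mul_sq hp hz (u := ⟨b / c ^ 2, hu.le⟩)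
    (PadicInt.toZMod_ne_zero_iff_norm_eq_one.2 hu)
  refine ⟨c * x, c * y, ?_⟩
  have hxy' : b / c ^ 2 = x ^ 2 - z * y ^ 2 := hxy
  rw [div_eq_iff (pow_ne_zero 2 hc)] at hxy'
  linear_combination hxy'

theorem nonempty_quaternionAlgebra_algEquiv_matrix_iff (hp : p ≠ 2) {z : ℤ_[p]}
    (hz : PadicInt.toZMod z ≠ 0) {b : ℚ_[p]} (hb : b ≠ 0) :
    Nonempty (ℍ[ℚ_[p], (z : ℚ_[p]), b] ≃ₐ[ℚ_[p]] Matrix (Fin 2) (Fin 2) ℚ_[p]) ↔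
      IsSquare (z : ℚ_[p]) ∨ Even b.valuation := by
  have hz0 : (z : ℚ_[p]) ≠ 0 := fun h => hz (by rw [PadicInt.coe_eq_zero.1 h, map_zero])
  constructor
  · rintro ⟨e⟩
    refine or_iff_not_imp_left.2 fun hsq => ?_
    have hsq' : ¬IsSquare (PadicInt.toZMod z) := by
      rwa [← PadicInt.isSquare_iff_isSquare_toZMod hp hz, ← isSquare_coe_iff]
    have anisotropic : ∀ x y : ℚ_[p], x ^ 2 - z * y ^ 2 = 0 → x = 0 ∧ y = 0 := by
      intro x y h
      have hy : y = 0 := by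
        by_contra hy
        refine hsq ⟨x / y, ?_⟩
        field_simp
        linear_combination -h
      subst hy
      simpa using h
    obtain ⟨q, hq, h⟩ := QuaternionAlgebra.exists_norm_eq_zero_of_algEquiv_matrix e
    have hJK : q.imJ ^ 2 - z * q.imK ^ 2 ≠ 0 := by
      intro h0
      obtain ⟨hJ, hK⟩ := anisotropic _ _ h0
      obtain ⟨hR, hI⟩ := anisotropic _ _ (h.trans (by rw [h0, mul_zero]))
      exact hq (QuaternionAlgebra.ext hR hI hJ hK)
    have hv := congrArg valuation h
    rw [valuation_mul hb hJK] at hv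
    have h1 := even_valuation_sq_sub_mul_sq hsq' q.re q.imI
    rw [hv, Int.even_add] at h1
    exact h1.2 (even_valuation_sq_sub_mul_sq hsq' q.imJ q.imK)
  · intro h
    obtain ⟨x, y, hxy⟩ : ∃ x y : ℚ_[p], b = x ^ 2 - z * y ^ 2 := by
      rcases h with ⟨c, hc⟩ | h
      · have hc0 : c ≠ 0 := by
          rintro rfl
          simp [hc] at hz0
        refine ⟨(1 + b) / 2, (b - 1) / (2 * c), ?_⟩
        rw [hc]
        field_simp
        ring
      · exact exists_eq_sq_sub_mul_sq_of_even_valuation hp hz hb h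
    exact QuaternionAlgebra.nonempty_algEquiv_matrix_of_eq_sq_sub_mul_sq two_ne_zero hz0 hb hxy

end Padic

/-- Let `p` be an odd prime, let `a ∈ ℚ_p` be nonzero with `p`-adic
valuation `0`, and let `b ∈ ℚ_p` be nonzero.  Then `ℍ[ℚ_p, a, b] ≅ M₂(ℚ_p)` as
`ℚ_p`-algebras if and only if `a` is a square in `ℚ_p` or the valuation `v(b)` is even.
Equivalently, the Hilbert symbol satisfies `(a,b)_p = (a/p)^{v(b)}`, where `(a/p)` is
the Legendre symbol of the residue of `a` (here `z` is `a`, viewed as a `p`-adic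
integer). -/
theorem padic_hilbertSym_of_unit
    (p : ℕ) [Fact p.Prime] (hp : p ≠ 2)
    (a b : ℚ_[p]) (ha : a ≠ 0) (hva : a.valuation = 0) (hb : b ≠ 0)
    (z : ℤ_[p]) (hz : (z : ℚ_[p]) = a) :
    (Nonempty (ℍ[ℚ_[p], a, b] ≃ₐ[ℚ_[p]] Matrix (Fin 2) (Fin 2) ℚ_[p]) ↔
      (IsSquare a ∨ Even b.valuation)) ∧
    (hilbertSym ℚ_[p] a b : ℚ) =
      ((legendreSym p ((PadicInt.toZMod z).val) : ℚ) ^ (b.valuation)) := by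
  subst hz
  have hz0 : PadicInt.toZMod z ≠ 0 := PadicInt.toZMod_ne_zero_iff_norm_eq_one.2
    ((Padic.norm_eq_one_iff_valuation_eq_zero ha).2 hva)
  have hiff := Padic.nonempty_quaternionAlgebra_algEquiv_matrix_iff hp hz0 hb
  refine ⟨hiff, ?_⟩
  have hcast : (((PadicInt.toZMod z).val : ℤ) : ZMod p) = PadicInt.toZMod z := by
    rw [Int.cast_natCast, ZMod.natCast_zmod_val]
  have hsq : IsSquare (z : ℚ_[p]) ↔ IsSquare (PadicInt.toZMod z) :=
    Padic.isSquare_coe_iff.trans (PadicInt.isSquare_iff_isSquare_toZMod hp hz0)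
  rw [hilbertSym, hiff, hsq]
  by_cases h : IsSquare (PadicInt.toZMod z)
  · have hl : legendreSym p ((PadicInt.toZMod z).val) = 1 :=
      (legendreSym.eq_one_iff p (by rwa [hcast])).2 (by rwa [hcast])
    rw [hl]
    simp [h]
  · have hl : legendreSym p ((PadicInt.toZMod z).val) = -1 :=
      (legendreSym.eq_neg_one_iff p).2 (by rwa [hcast])
    rw [hl]
    by_cases hv : Even b.valuation
    · simp [hv, hv.neg_one_zpow]
    · simp [h, hv, (Int.not_even_iff_odd.1 hv).neg_one_zpow]
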